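/- Let n ≥ 1 and let A and B be irreducible nonnegative n×n real matrices such that graph(A) is a subgraph of graph(B). Then the SRUC game (A, B) has a unique Nash equilibrium: if (x₁, y₁) and (x₂, y₂) are both Nash equilibria of the SRUC game (A, B), then x₁ = x₂ and y₁ = y₂. -/

import Mathlib

open Finset

/-- Inner product `xᵀy`. -/
noncomputable def dotp {n : ℕ} (x y : Fin n → ℝ) : ℝ := ∑ i, x i * y i

/-- Bilinear form `xᵀCy`. -/
noncomputable def quadForm {n : ℕ} (C : Matrix (Fin n) (Fin n) ℝ) (x y : Fin n → ℝ) : ℝ :=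
  ∑ i, ∑ j, x i * C i j * y j

/-- The SRUC payoff `e^C(x,y) ∈ [0,∞]`. -/
noncomputable def payoff {n : ℕ} (C : Matrix (Fin n) (Fin n) ℝ) (x y : Fin n → ℝ) : ENNReal :=
  if 0 < dotp x y then ENNReal.ofReal (quadForm C x y / dotp x y)
  else if 0 < quadForm C x y then ⊤ else 0

/-- The standard simplex `Δ_n`. -/
def simplex (n : ℕ) : Set (Fin n → ℝ) := {x | (∀ i, 0 ≤ x i) ∧ ∑ i, x i = 1}

/-- Nash equilibrium of the SRUC game `(A, B)`. -/
def IsNash {n : ℕ} (A B : Matrix (Fin n) (Fin n) ℝ) (xs ys : Fin n → ℝ) : Prop :=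
  xs ∈ simplex n ∧ ys ∈ simplex n ∧
  (∀ x ∈ simplex n, payoff A x ys ≤ payoff A xs ys) ∧
  (∀ y ∈ simplex n, payoff B xs ys ≤ payoff B xs y)

/-- `C` is irreducible: `graph(C)` (edges `(i,j)` with `i ≠ j`, `C i j > 0`) is
strongly connected. -/
def MatIrreducible {n : ℕ} (C : Matrix (Fin n) (Fin n) ℝ) : Prop :=
  ∀ i j : Fin n, Relation.ReflTransGen (fun a b => a ≠ b ∧ 0 < C a b) i j

open scoped Matrix

lemma MatIrreducible.transpose {n : ℕ} {C : Matrix (Fin n) (Fin n) ℝ} (h : MatIrreducible C) :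
    MatIrreducible Cᵀ := by
  intro i j
  exact Relation.ReflTransGen.mono (fun a b hab => ⟨hab.1.symm, hab.2⟩) _ _
    (Relation.ReflTransGen.swap _ _ (h j i))

lemma mulVec_apply_nonneg {n : ℕ} {C : Matrix (Fin n) (Fin n) ℝ} (hC : ∀ i j, 0 ≤ C i j)
    {w : Fin n → ℝ} (hw : ∀ i, 0 ≤ w i) (i : Fin n) : 0 ≤ (C *ᵥ w) i := by
  rw [Matrix.mulVec, dotProduct]
  exact Finset.sum_nonneg fun j _ => mul_nonneg (hC i j) (hw j)

/-- The zero set of a nonnegative vector that is preserved by an irreducible nonnegative matrix is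
empty or everything. -/
lemma MatIrreducible.eq_zero_of_apply_eq_zero {n : ℕ} {C : Matrix (Fin n) (Fin n) ℝ}
    (hC : ∀ i j, 0 ≤ C i j) (hirr : MatIrreducible C) {w : Fin n → ℝ} (hw : ∀ i, 0 ≤ w i)
    (hz : ∀ i, w i = 0 → (C *ᵥ w) i = 0) {k : Fin n} (hk : w k = 0) : w = 0 := by
  funext j
  induction hirr k j with
  | refl => exact hk
  | @tail b c _ hbc ih =>
    have hsum := hz b ih
    rw [Matrix.mulVec, dotProduct,
      Finset.sum_eq_zero_iff_of_nonneg fun i _ => mul_nonneg (hC b i) (hw i)] at hsum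
    exact (mul_eq_zero.mp (hsum c (mem_univ c))).resolve_left hbc.2.ne'

lemma ne_zero_of_mem_simplex {n : ℕ} {x : Fin n → ℝ} (hx : x ∈ simplex n) : x ≠ 0 := by
  rintro rfl
  simpa using hx.2

lemma single_mem_simplex {n : ℕ} (i : Fin n) : Pi.single i (1 : ℝ) ∈ simplex n := by
  refine ⟨fun j => ?_, by simp⟩
  by_cases h : j = i
  · subst h; simp
  · simp [h]

/-- A nonnegative eigenvector of an irreducible nonnegative matrix is positive. -/
lemma MatIrreducible.pos_of_mulVec_eq {n : ℕ} {C : Matrix (Fin n) (Fin n) ℝ}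
    (hC : ∀ i j, 0 ≤ C i j) (hirr : MatIrreducible C) {u : Fin n → ℝ} (hu : u ∈ simplex n)
    {r : ℝ} (hev : C *ᵥ u = r • u) (i : Fin n) : 0 < u i := by
  refine (hu.1 i).lt_of_ne' fun hi => ne_zero_of_mem_simplex hu ?_
  exact hirr.eq_zero_of_apply_eq_zero hC hu.1 (fun k hk => by simp [hev, hk]) hi

/-- For positive vectors `u`, `v`, the largest multiple of `v` below `u` touches `u`. -/
lemma exists_smul_le_touching {n : ℕ} [NeZero n] {u v : Fin n → ℝ} (hv : ∀ i, 0 < v i) :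
    ∃ t k, (∀ i, t * v i ≤ u i) ∧ u k = t * v k := by
  obtain ⟨k, -, hk⟩ := Finset.exists_min_image univ (fun i => u i / v i) univ_nonempty
  refine ⟨u k / v k, k, fun i => ?_, (div_mul_cancel₀ _ (hv k).ne').symm⟩
  exact (le_div_iff₀ (hv i)).mp (hk i (mem_univ i))

/-- Positive eigenvectors of a nonnegative matrix have comparable, hence equal, eigenvalues. -/
lemma eigenvalue_le {n : ℕ} [NeZero n] {C : Matrix (Fin n) (Fin n) ℝ} (hC : ∀ i j, 0 ≤ C i j)
    {u v : Fin n → ℝ} (hu : ∀ i, 0 < u i) (hv : ∀ i, 0 < v i) {r s : ℝ}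
    (hur : C *ᵥ u = r • u) (hvs : C *ᵥ v = s • v) : s ≤ r := by
  obtain ⟨t, k, ht, hk⟩ := exists_smul_le_touching (u := u) hv
  have hnonneg : 0 ≤ (C *ᵥ (u - t • v)) k :=
    mulVec_apply_nonneg hC (fun j => by simpa using ht j) k
  rw [Matrix.mulVec_sub, Matrix.mulVec_smul, hur, hvs] at hnonneg
  simp only [Pi.sub_apply, Pi.smul_apply, smul_eq_mul] at hnonneg
  have hle : s * u k ≤ r * u k := by
    have : t * (s * v k) = s * u k := by rw [hk]; ring
    linarith
  exact le_of_mul_le_mul_right hle (hu k)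

/-- Uniqueness of the Perron vector of an irreducible nonnegative matrix. -/
lemma MatIrreducible.perron_unique {n : ℕ} [NeZero n] {C : Matrix (Fin n) (Fin n) ℝ}
    (hC : ∀ i j, 0 ≤ C i j) (hirr : MatIrreducible C) {u v : Fin n → ℝ}
    (hu : u ∈ simplex n) (hv : v ∈ simplex n) {r s : ℝ}
    (hur : C *ᵥ u = r • u) (hvs : C *ᵥ v = s • v) : u = v := by
  have hu' := hirr.pos_of_mulVec_eq hC hu hur
  have hv' := hirr.pos_of_mulVec_eq hC hv hvs
  obtain rfl : r = s := le_antisymm (eigenvalue_le hC hv' hu' hvs hur)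
    (eigenvalue_le hC hu' hv' hur hvs)
  obtain ⟨t, k, ht, hk⟩ := exists_smul_le_touching (u := u) hv'
  have hev : C *ᵥ (u - t • v) = r • (u - t • v) := by
    rw [Matrix.mulVec_sub, Matrix.mulVec_smul, hur, hvs, smul_sub, smul_comm]
  have hzero : u - t • v = 0 :=
    hirr.eq_zero_of_apply_eq_zero hC (fun i => by simpa using ht i)
      (fun i hi => by rw [hev, Pi.smul_apply, hi, smul_zero]) (k := k) (by simp [hk])
  have huv : u = t • v := sub_eq_zero.mp hzero
  have ht1 : t = 1 := by
    have hsum := hu.2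
    rw [huv] at hsum
    simpa [← Finset.mul_sum, hv.2] using hsum
  rw [huv, ht1, one_smul]

lemma quadForm_eq_sum_mulVec {n : ℕ} (C : Matrix (Fin n) (Fin n) ℝ) (x y : Fin n → ℝ) :
    quadForm C x y = ∑ i, x i * (C *ᵥ y) i := by
  simp [quadForm, Matrix.mulVec, dotProduct, Finset.mul_sum, mul_assoc]

lemma quadForm_single {n : ℕ} (C : Matrix (Fin n) (Fin n) ℝ) (i : Fin n) (y : Fin n → ℝ) :
    quadForm C (Pi.single i 1) y = (C *ᵥ y) i := by
  simp [quadForm_eq_sum_mulVec, Pi.single_apply]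

lemma dotp_single {n : ℕ} (i : Fin n) (y : Fin n → ℝ) : dotp (Pi.single i 1) y = y i := by
  simp [dotp, Pi.single_apply]

lemma dotp_comm {n : ℕ} (x y : Fin n → ℝ) : dotp x y = dotp y x := by
  simp [dotp, mul_comm]

lemma quadForm_transpose {n : ℕ} (C : Matrix (Fin n) (Fin n) ℝ) (x y : Fin n → ℝ) :
    quadForm Cᵀ x y = quadForm C y x := by
  rw [quadForm, quadForm, Finset.sum_comm]
  refine Finset.sum_congr rfl fun i _ => Finset.sum_congr rfl fun j _ => ?_
  rw [Matrix.transpose_apply]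
  ring

lemma payoff_transpose {n : ℕ} (C : Matrix (Fin n) (Fin n) ℝ) (x y : Fin n → ℝ) :
    payoff Cᵀ x y = payoff C y x := by
  rw [payoff, payoff, quadForm_transpose, dotp_comm]

lemma quadForm_nonneg {n : ℕ} {C : Matrix (Fin n) (Fin n) ℝ} (hC : ∀ i j, 0 ≤ C i j)
    {x y : Fin n → ℝ} (hx : ∀ i, 0 ≤ x i) (hy : ∀ i, 0 ≤ y i) : 0 ≤ quadForm C x y :=
  Finset.sum_nonneg fun i _ => Finset.sum_nonneg fun j _ =>
    mul_nonneg (mul_nonneg (hx i) (hC i j)) (hy j)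

lemma payoff_eq_top_iff {n : ℕ} {C : Matrix (Fin n) (Fin n) ℝ} {x y : Fin n → ℝ} :
    payoff C x y = ⊤ ↔ dotp x y ≤ 0 ∧ 0 < quadForm C x y := by
  unfold payoff
  split_ifs with h1 h2
  · simp [h1]
  · simp [h2, not_lt.mp h1]
  · simp [h2]

lemma dotp_self_pos {n : ℕ} {x : Fin n → ℝ} (hx : x ∈ simplex n) : 0 < dotp x x := by
  obtain ⟨i, hi⟩ := Function.ne_iff.mp (ne_zero_of_mem_simplex hx)
  exact Finset.sum_pos' (fun j _ => mul_self_nonneg _) ⟨i, mem_univ i, mul_self_pos.mpr hi⟩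

/-- With disjoint supports only off-diagonal entries contribute to the bilinear form. -/
lemma quadForm_pos_of_subgraph {n : ℕ} {A B : Matrix (Fin n) (Fin n) ℝ}
    (hB : ∀ i j, 0 ≤ B i j) (hsub : ∀ i j : Fin n, i ≠ j → 0 < A i j → 0 < B i j)
    {x y : Fin n → ℝ} (hx : ∀ i, 0 ≤ x i) (hy : ∀ i, 0 ≤ y i) (hxy : dotp x y ≤ 0)
    (hpos : 0 < quadForm A x y) : 0 < quadForm B x y := by
  have hdisj : ∀ i, x i * y i = 0 := fun i =>
    (Finset.sum_eq_zero_iff_of_nonneg fun i _ => mul_nonneg (hx i) (hy i)).mp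
      (le_antisymm hxy (Finset.sum_nonneg fun i _ => mul_nonneg (hx i) (hy i))) i (mem_univ i)
  refine (quadForm_nonneg hB hx hy).lt_of_ne' fun hzero => hpos.not_ge ?_
  have hterm : ∀ i j, 0 ≤ x i * B i j * y j := fun i j =>
    mul_nonneg (mul_nonneg (hx i) (hB i j)) (hy j)
  refine Finset.sum_nonpos fun i _ => Finset.sum_nonpos fun j _ => ?_
  have hBij : x i * B i j * y j = 0 := by
    have hrow := (Finset.sum_eq_zero_iff_of_nonneg fun i _ =>
      Finset.sum_nonneg fun j _ => hterm i j).mp hzero i (mem_univ i)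
    exact (Finset.sum_eq_zero_iff_of_nonneg fun j _ => hterm i j).mp hrow j (mem_univ j)
  by_cases hij : i = j
  · subst hij
    rw [mul_right_comm, hdisj, zero_mul]
  by_cases hAij : 0 < A i j
  · have hB0 := (hsub i j hij hAij).ne'
    have hxy0 : x i * y j = 0 := by
      have : x i * y j * B i j = 0 := by rw [← hBij]; ring
      exact (mul_eq_zero.mp this).resolve_right hB0
    rw [mul_right_comm, hxy0, zero_mul]
  · exact mul_nonpos_of_nonpos_of_nonneg
      (mul_nonpos_of_nonneg_of_nonpos (hx i) (not_lt.mp hAij)) (hy j)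

/-- In equilibrium the minimizing player uses every strategy. -/
lemma IsNash.right_pos {n : ℕ} {A B : Matrix (Fin n) (Fin n) ℝ}
    (hA : ∀ i j, 0 ≤ A i j) (hB : ∀ i j, 0 ≤ B i j) (hAirr : MatIrreducible A)
    (hsub : ∀ i j : Fin n, i ≠ j → 0 < A i j → 0 < B i j) {x y : Fin n → ℝ}
    (h : IsNash A B x y) (i : Fin n) : 0 < y i := by
  obtain ⟨hx, hy, hmax, hmin⟩ := h
  refine (hy.1 i).lt_of_ne' fun hi => ne_zero_of_mem_simplex hy ?_
  refine hAirr.eq_zero_of_apply_eq_zero hA hy.1 (fun k hk => ?_) hi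
  by_contra hne
  have hpos : 0 < (A *ᵥ y) k := (mulVec_apply_nonneg hA hy.1 k).lt_of_ne' hne
  have htop : payoff A (Pi.single k 1) y = ⊤ :=
    payoff_eq_top_iff.mpr ⟨by rw [dotp_single, hk], by rwa [quadForm_single]⟩
  have hAtop : payoff A x y = ⊤ := top_le_iff.mp (htop ▸ hmax _ (single_mem_simplex k))
  obtain ⟨hdot, hq⟩ := payoff_eq_top_iff.mp hAtop
  have hBtop : payoff B x y = ⊤ :=
    payoff_eq_top_iff.mpr ⟨hdot, quadForm_pos_of_subgraph hB hsub hx.1 hy.1 hdot hq⟩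
  have hself : payoff B x x = ⊤ := top_le_iff.mp (hBtop ▸ hmin x hx)
  exact (payoff_eq_top_iff.mp hself).1.not_gt (dotp_self_pos hx)

lemma payoff_eq_ofReal {n : ℕ} (C : Matrix (Fin n) (Fin n) ℝ) {x y : Fin n → ℝ}
    (h : 0 < dotp x y) : payoff C x y = ENNReal.ofReal (quadForm C x y / dotp x y) :=
  if_pos h

lemma sum_mul_mulVec_sub {n : ℕ} (C : Matrix (Fin n) (Fin n) ℝ) {x y : Fin n → ℝ}
    (h : 0 < dotp x y) :
    ∑ i, x i * ((C *ᵥ y) i - quadForm C x y / dotp x y * y i) = 0 := by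
  have hsplit : ∑ i, x i * ((C *ᵥ y) i - quadForm C x y / dotp x y * y i) =
      quadForm C x y - quadForm C x y / dotp x y * dotp x y := by
    rw [quadForm_eq_sum_mulVec C x y, dotp, Finset.mul_sum, ← Finset.sum_sub_distrib]
    exact Finset.sum_congr rfl fun i _ => by ring
  rw [hsplit, div_mul_cancel₀ _ h.ne', sub_self]

lemma dotp_pos {n : ℕ} {x y : Fin n → ℝ} (hx : x ∈ simplex n) (hy : ∀ i, 0 < y i) :
    0 < dotp x y := by
  obtain ⟨i, hi⟩ := Function.ne_iff.mp (ne_zero_of_mem_simplex hx)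
  exact Finset.sum_pos' (fun j _ => mul_nonneg (hx.1 j) (hy j).le)
    ⟨i, mem_univ i, mul_pos ((hx.1 i).lt_of_ne' hi) (hy i)⟩

/-- A positive minimizer against `y` makes `y` an eigenvector. -/
lemma mulVec_eq_of_minimizer {n : ℕ} {C : Matrix (Fin n) (Fin n) ℝ} (hC : ∀ i j, 0 ≤ C i j)
    {x y : Fin n → ℝ} (hx : ∀ i, 0 < x i) (hy : y ∈ simplex n)
    (hmin : ∀ z ∈ simplex n, payoff C x y ≤ payoff C z y) :
    C *ᵥ y = (quadForm C x y / dotp x y) • y := by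
  have hdot : 0 < dotp x y := dotp_comm x y ▸ dotp_pos hy hx
  have hCy : ∀ i, 0 ≤ (C *ᵥ y) i := mulVec_apply_nonneg hC hy.1
  have hterm : ∀ i, 0 ≤ (C *ᵥ y) i - quadForm C x y / dotp x y * y i := by
    intro i
    rcases (hy.1 i).eq_or_lt with hi | hi
    · simpa [← hi] using hCy i
    · have hle := hmin _ (single_mem_simplex i)
      rw [payoff_eq_ofReal C hdot, payoff_eq_ofReal C (by rwa [dotp_single]), quadForm_single,
        dotp_single, ENNReal.ofReal_le_ofReal_iff (div_nonneg (hCy i) hi.le), le_div_iff₀ hi] at hle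
      exact sub_nonneg.mpr hle
  funext i
  have hzero := (Finset.sum_eq_zero_iff_of_nonneg fun i _ => mul_nonneg (hx i).le (hterm i)).mp
    (sum_mul_mulVec_sub C hdot) i (mem_univ i)
  exact sub_eq_zero.mp ((mul_eq_zero.mp hzero).resolve_left (hx i).ne')

/-- A positive maximizer against a positive `y` makes `y` an eigenvector. -/
lemma mulVec_eq_of_maximizer {n : ℕ} {C : Matrix (Fin n) (Fin n) ℝ} (hC : ∀ i j, 0 ≤ C i j)
    {x y : Fin n → ℝ} (hx : ∀ i, 0 < x i) (hy : y ∈ simplex n) (hy' : ∀ i, 0 < y i)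
    (hmax : ∀ z ∈ simplex n, payoff C z y ≤ payoff C x y) :
    C *ᵥ y = (quadForm C x y / dotp x y) • y := by
  have hdot : 0 < dotp x y := dotp_comm x y ▸ dotp_pos hy hx
  have hterm : ∀ i, (C *ᵥ y) i - quadForm C x y / dotp x y * y i ≤ 0 := by
    intro i
    have hle := hmax _ (single_mem_simplex i)
    rw [payoff_eq_ofReal C hdot, payoff_eq_ofReal C (by rw [dotp_single]; exact hy' i),
      quadForm_single, dotp_single, ENNReal.ofReal_le_ofReal_iff
        (div_nonneg (quadForm_nonneg hC (fun j => (hx j).le) hy.1) hdot.le),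
      div_le_iff₀ (hy' i)] at hle
    exact sub_nonpos.mpr hle
  funext i
  have hzero := (Finset.sum_eq_zero_iff_of_nonpos fun i _ =>
    mul_nonpos_of_nonneg_of_nonpos (hx i).le (hterm i)).mp
    (sum_mul_mulVec_sub C hdot) i (mem_univ i)
  exact sub_eq_zero.mp ((mul_eq_zero.mp hzero).resolve_left (hx i).ne')

/-- Equilibrium strategies are eigenvectors of `Bᵀ` and `A` respectively. -/
lemma IsNash.exists_eigenvalues {n : ℕ} {A B : Matrix (Fin n) (Fin n) ℝ}
    (hA : ∀ i j, 0 ≤ A i j) (hB : ∀ i j, 0 ≤ B i j)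
    (hAirr : MatIrreducible A) (hBirr : MatIrreducible B)
    (hsub : ∀ i j : Fin n, i ≠ j → 0 < A i j → 0 < B i j) {x y : Fin n → ℝ}
    (h : IsNash A B x y) : (∃ r : ℝ, Bᵀ *ᵥ x = r • x) ∧ ∃ s : ℝ, A *ᵥ y = s • y := by
  have hy := h.right_pos hA hB hAirr hsub
  obtain ⟨hxs, hys, hmax, hmin⟩ := h
  have hev := mulVec_eq_of_minimizer (C := Bᵀ) (fun i j => hB j i) hy hxs
    (fun z hz => by simpa only [payoff_transpose] using hmin z hz)
  have hx := hBirr.transpose.pos_of_mulVec_eq (fun i j => hB j i) hxs hev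
  exact ⟨⟨_, hev⟩, _, mulVec_eq_of_maximizer hA hx hys hy hmax⟩

theorem stmt8 (n : ℕ) (hn : 1 ≤ n) (A B : Matrix (Fin n) (Fin n) ℝ)
    (hA : ∀ i j, 0 ≤ A i j) (hB : ∀ i j, 0 ≤ B i j)
    (hAirr : MatIrreducible A) (hBirr : MatIrreducible B)
    (hsub : ∀ i j : Fin n, i ≠ j → 0 < A i j → 0 < B i j)
    (x₁ y₁ x₂ y₂ : Fin n → ℝ)
    (h1 : IsNash A B x₁ y₁) (h2 : IsNash A B x₂ y₂) :
    x₁ = x₂ ∧ y₁ = y₂ := by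
  have : NeZero n := ⟨by omega⟩
  obtain ⟨⟨r₁, hx₁⟩, s₁, hy₁⟩ := h1.exists_eigenvalues hA hB hAirr hBirr hsub
  obtain ⟨⟨r₂, hx₂⟩, s₂, hy₂⟩ := h2.exists_eigenvalues hA hB hAirr hBirr hsub
  exact ⟨hBirr.transpose.perron_unique (fun i j => hB j i) h1.1 h2.1 hx₁ hx₂,
    hAirr.perron_unique hA h1.2.1 h2.2.1 hy₁ hy₂⟩
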